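/- arXiv:2407.20149 — 3 statements merged into one kernel-verified Lean document; each statement's English description precedes it below -/
import Mathlib

section
/- Let k ≥ 1 and let p_1, …, p_k ∈ ℝ³ ∖ {0} be such that the points 0, ±p_1, …, ±p_k are pairwise distinct. Then there exist constants C > 0 and R > 0, depending only on p_1, …, p_k, such that for every ε ∈ (0,1] and every x ∈ ℝ³ with ‖x‖ ≥ R, one has | h_ε(x) − 1 − ε(k−1)/‖x‖ | ≤ C ε / ‖x‖³. (This is the asymptotic expansion h_ε = 1 + ε(2k−2)/(2‖x‖) + O(ε‖x‖^{−3}) for ‖x‖ ≫ 1, which after quotient by the involution x ↦ −x gives the asymptotic topology of a dihedral D_{k+1} ALF space.) -/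
open Finset

/-- The harmonic potential of the adiabatic Gibbons–Hawking ansatz. -/
noncomputable def hpot (k : ℕ) (ε : ℝ) (p : Fin k → EuclideanSpace ℝ (Fin 3))
    (x : EuclideanSpace ℝ (Fin 3)) : ℝ :=
  1 - ε / ‖x‖ + ∑ v, (ε / (2 * ‖x + p v‖) + ε / (2 * ‖x - p v‖))

/-- The mean of the Newtonian potentials of two antipodal sources has no dipole term. -/
theorem abs_mean_inv_norm_sub_le {E : Type*} [NormedAddCommGroup E] [InnerProductSpace ℝ E]
    {x q : E} (hx : 0 < ‖x‖) (hq : 2 * ‖q‖ ≤ ‖x‖) :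
    |1 / (2 * ‖x + q‖) + 1 / (2 * ‖x - q‖) - 1 / ‖x‖| ≤ 6 * ‖q‖ ^ 2 / ‖x‖ ^ 3 := by
  have hpar := parallelogram_law_with_norm ℝ x q
  have ha₁ : ‖x + q‖ ≤ ‖x‖ + ‖q‖ := norm_add_le x q
  have hb₁ : ‖x - q‖ ≤ ‖x‖ + ‖q‖ := norm_sub_le x q
  have ha₂ : ‖x‖ - ‖q‖ ≤ ‖x + q‖ := by simpa using norm_sub_norm_le x (-q)
  have hb₂ : ‖x‖ - ‖q‖ ≤ ‖x - q‖ := norm_sub_norm_le x q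
  generalize ‖x + q‖ = a at *
  generalize ‖x - q‖ = b at *
  generalize ‖x‖ = r at *
  generalize ‖q‖ = d at *
  have ha : r / 2 ≤ a := by linarith
  have hb : r / 2 ≤ b := by linarith
  have ha₀ : 0 < a := by linarith
  have hb₀ : 0 < b := by linarith
  have hs : (a - r) ^ 2 ≤ d ^ 2 := by nlinarith
  have ht : (b - r) ^ 2 ≤ d ^ 2 := by nlinarith
  have hnum : |r * (a + b) - 2 * (a * b)| ≤ 3 * d ^ 2 := by
    rw [abs_le]
    constructor <;>
      nlinarith [sq_nonneg ((a - r) + (b - r)), sq_nonneg ((a - r) - (b - r)),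
        sq_nonneg (a - r), sq_nonneg (b - r)]
  have hden : r ^ 3 / 2 ≤ 2 * (a * b) * r := by
    have : r / 2 * (r / 2) ≤ a * b := by gcongr
    nlinarith
  have heq : 1 / (2 * a) + 1 / (2 * b) - 1 / r =
      (r * (a + b) - 2 * (a * b)) / (2 * (a * b) * r) := by
    field_simp
    ring
  rw [heq, abs_div, abs_of_pos (by positivity : 0 < 2 * (a * b) * r)]
  calc |r * (a + b) - 2 * (a * b)| / (2 * (a * b) * r)
      ≤ 3 * d ^ 2 / (r ^ 3 / 2) := by gcongr
    _ = 6 * d ^ 2 / r ^ 3 := by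
      field_simp
      ring

/-- Asymptotic expansion `h_ε = 1 + ε(2k−2)/(2‖x‖) + O(ε‖x‖⁻³)` at infinity. -/
theorem hpot_asymptotic_expansion (k : ℕ) (hk : 1 ≤ k)
    (p : Fin k → EuclideanSpace ℝ (Fin 3))
    (hp0 : ∀ v, p v ≠ 0)
    (hpd : ∀ v w, v ≠ w → p v ≠ p w ∧ p v ≠ -p w) :
    ∃ C > (0 : ℝ), ∃ R > (0 : ℝ), ∀ ε : ℝ, 0 < ε → ε ≤ 1 →
      ∀ x : EuclideanSpace ℝ (Fin 3), R ≤ ‖x‖ →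
        |hpot k ε p x - 1 - ε * ((k : ℝ) - 1) / ‖x‖| ≤ C * ε / ‖x‖ ^ 3 := by
  refine ⟨1 + ∑ v, 6 * ‖p v‖ ^ 2, by positivity, 1 + ∑ v, 2 * ‖p v‖, by positivity, ?_⟩
  intro ε hε _ x hR
  have hsum : 0 ≤ ∑ v, 2 * ‖p v‖ := sum_nonneg fun v _ ↦ mul_nonneg zero_le_two (norm_nonneg _)
  have hx : 0 < ‖x‖ := by linarith
  have hpx (v : Fin k) : 2 * ‖p v‖ ≤ ‖x‖ := by
    have hle : 2 * ‖p v‖ ≤ ∑ w, 2 * ‖p w‖ :=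
      single_le_sum (f := fun w ↦ 2 * ‖p w‖)
        (fun w _ ↦ mul_nonneg zero_le_two (norm_nonneg _)) (mem_univ v)
    linarith
  have heq : hpot k ε p x - 1 - ε * ((k : ℝ) - 1) / ‖x‖ =
      ε * ∑ v, (1 / (2 * ‖x + p v‖) + 1 / (2 * ‖x - p v‖) - 1 / ‖x‖) := by
    have hmul : ∑ v, (ε / (2 * ‖x + p v‖) + ε / (2 * ‖x - p v‖)) =
        ε * ∑ v, (1 / (2 * ‖x + p v‖) + 1 / (2 * ‖x - p v‖)) := by
      rw [mul_sum]
      exact sum_congr rfl fun v _ ↦ by ring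
    rw [hpot, hmul, sum_sub_distrib, sum_const, card_univ, Fintype.card_fin, nsmul_eq_mul]
    ring
  rw [heq, abs_mul, abs_of_pos hε]
  calc ε * |∑ v, (1 / (2 * ‖x + p v‖) + 1 / (2 * ‖x - p v‖) - 1 / ‖x‖)|
      ≤ ε * ∑ v, 6 * ‖p v‖ ^ 2 / ‖x‖ ^ 3 := by
        gcongr
        exact (abs_sum_le_sum_abs _ _).trans
          (sum_le_sum fun v _ ↦ abs_mean_inv_norm_sub_le hx (hpx v))
    _ = (∑ v, 6 * ‖p v‖ ^ 2) * ε / ‖x‖ ^ 3 := by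
        rw [← sum_div]
        ring
    _ ≤ (1 + ∑ v, 6 * ‖p v‖ ^ 2) * ε / ‖x‖ ^ 3 := by
        gcongr
        linarith
end

section
/- Let k ≥ 1 and let p_1, …, p_k ∈ ℝ³ ∖ {0} be such that the points 0, ±p_1, …, ±p_k are pairwise distinct. Then there exist constants C > 0 and R > 0, depending only on p_1, …, p_k, such that for every ε ∈ (0,1] and every x ∈ ℝ³ with ‖x‖ ≥ R, the gradient of h_ε satisfies ‖ ∇h_ε(x) + ε(k−1) x/‖x‖³ ‖ ≤ C ε / ‖x‖⁴. -/
open Finset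

section InverseNorm

variable {E : Type*} [NormedAddCommGroup E] [InnerProductSpace ℝ E]

theorem hasFDerivAt_div_norm_add (c : ℝ) (a : E) {x : E} (hx : x + a ≠ 0) :
    HasFDerivAt (fun y : E => c / ‖y + a‖)
      (-(c / ‖x + a‖ ^ 3) • innerSL ℝ (x + a)) x := by
  have hn : ‖x + a‖ ≠ 0 := norm_ne_zero_iff.mpr hx
  have hsq := ((hasFDerivAt_id (𝕜 := ℝ) x).add_const a).norm_sq
  have hsqrt := (hsq.sqrt (pow_ne_zero 2 hn)).congr_of_eventuallyEq
    (f₁ := fun y : E => ‖y + a‖) (.of_forall fun y => (Real.sqrt_sq (norm_nonneg _)).symm)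
  have hdiv := ((hasDerivAt_inv hn).const_mul c).comp_hasFDerivAt x hsqrt
  refine (hdiv.congr_fderiv ?_).congr_of_eventuallyEq
    (.of_forall fun y => by simp [div_eq_mul_inv])
  ext v
  simp only [Real.sqrt_sq (norm_nonneg _), smul_apply, smul_eq_mul,
    nsmul_eq_mul, Nat.cast_ofNat, id, ContinuousLinearMap.comp_id]
  field_simp

theorem abs_inv_cube_sub_taylor_le {r u : ℝ} (hr : 0 < r) (hu : r / 2 ≤ u) :
    |1 / u ^ 3 - 1 / r ^ 3 + 3 * (u - r) / r ^ 4| ≤ 22 * (u - r) ^ 2 / r ^ 5 := by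
  have hu0 : 0 < u := by linarith
  have hid : 1 / u ^ 3 - 1 / r ^ 3 + 3 * (u - r) / r ^ 4 =
      (u - r) ^ 2 * (3 * u ^ 2 + 2 * u * r + r ^ 2) / (u ^ 3 * r ^ 4) := by
    field_simp
    ring
  rw [hid, abs_of_nonneg (by positivity), div_le_div_iff₀ (by positivity) (by positivity)]
  have hpoly : (3 * u ^ 2 + 2 * u * r + r ^ 2) * r ≤ 22 * u ^ 3 := by
    obtain ⟨t, ht, rfl⟩ : ∃ t, 0 ≤ t ∧ r = 2 * u - t := ⟨2 * u - r, by linarith, by ring⟩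
    have h1 : (2 * u - t) ^ 2 ≤ (2 * u) ^ 2 := by gcongr; linarith
    have h2 : (2 * u - t) ^ 3 ≤ (2 * u) ^ 3 := by gcongr; linarith
    nlinarith [mul_nonneg (sq_nonneg u) ht, mul_le_mul_of_nonneg_left h1 hu0.le]
  calc (u - r) ^ 2 * (3 * u ^ 2 + 2 * u * r + r ^ 2) * r ^ 5
      = (u - r) ^ 2 * r ^ 4 * ((3 * u ^ 2 + 2 * u * r + r ^ 2) * r) := by ring
    _ ≤ (u - r) ^ 2 * r ^ 4 * (22 * u ^ 3) := by gcongr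
    _ = 22 * (u - r) ^ 2 * (u ^ 3 * r ^ 4) := by ring

/-- The symmetric second difference of the field `x / ‖x‖ ^ 3` gains two orders of decay. -/
theorem norm_second_difference_le {x q : E} (hx : 0 < ‖x‖) (hq : 2 * ‖q‖ ≤ ‖x‖) :
    ‖(2 / ‖x‖ ^ 3) • x - (1 / ‖x + q‖ ^ 3) • (x + q) - (1 / ‖x - q‖ ^ 3) • (x - q)‖ ≤
      75 * ‖q‖ ^ 2 / ‖x‖ ^ 4 := by
  have hpar := parallelogram_law_with_norm ℝ x q
  have hu : |‖x + q‖ - ‖x‖| ≤ ‖q‖ := by simpa using abs_norm_sub_norm_le (x + q) x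
  have hw : |‖x - q‖ - ‖x‖| ≤ ‖q‖ := by simpa using abs_norm_sub_norm_le (x - q) x
  have hvec : (2 / ‖x‖ ^ 3) • x - (1 / ‖x + q‖ ^ 3) • (x + q) - (1 / ‖x - q‖ ^ 3) • (x - q) =
      (2 / ‖x‖ ^ 3 - 1 / ‖x + q‖ ^ 3 - 1 / ‖x - q‖ ^ 3) • x +
        (1 / ‖x - q‖ ^ 3 - 1 / ‖x + q‖ ^ 3) • q := by
    module
  rw [hvec]
  have hadd := norm_add_le ((2 / ‖x‖ ^ 3 - 1 / ‖x + q‖ ^ 3 - 1 / ‖x - q‖ ^ 3) • x)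
    ((1 / ‖x - q‖ ^ 3 - 1 / ‖x + q‖ ^ 3) • q)
  rw [norm_smul, norm_smul, Real.norm_eq_abs, Real.norm_eq_abs] at hadd
  refine hadd.trans ?_
  have hs : 0 ≤ ‖q‖ := norm_nonneg q
  generalize ‖x + q‖ = u at *
  generalize ‖x - q‖ = w at *
  generalize ‖x‖ = r at *
  generalize ‖q‖ = s at *
  have hus : (u - r) ^ 2 ≤ s ^ 2 := sq_le_sq' (neg_le_of_abs_le hu) (le_of_abs_le hu)
  have hws : (w - r) ^ 2 ≤ s ^ 2 := sq_le_sq' (neg_le_of_abs_le hw) (le_of_abs_le hw)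
  have hsum : |u + w - 2 * r| ≤ s ^ 2 / r := by
    rw [le_div_iff₀ hx, ← abs_of_pos hx, ← abs_mul, abs_of_pos hx, abs_le]
    constructor <;> nlinarith [sq_nonneg (u - r), sq_nonneg (w - r)]
  have htaylor {z : ℝ} (hz : |z - r| ≤ s) (hzs : (z - r) ^ 2 ≤ s ^ 2) :
      |1 / z ^ 3 - 1 / r ^ 3 + 3 * (z - r) / r ^ 4| ≤ 22 * s ^ 2 / r ^ 5 :=
    (abs_inv_cube_sub_taylor_le hx (by linarith [neg_le_of_abs_le hz])).trans (by gcongr)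
  have htu := htaylor hu hus
  have htw := htaylor hw hws
  have hradial : |2 / r ^ 3 - 1 / u ^ 3 - 1 / w ^ 3| ≤ 47 * s ^ 2 / r ^ 5 := by
    have hlin : |3 * (u + w - 2 * r) / r ^ 4| ≤ 3 * s ^ 2 / r ^ 5 := by
      rw [abs_div, abs_mul, abs_of_pos (pow_pos hx 4), abs_of_pos (by norm_num : (0 : ℝ) < 3)]
      calc 3 * |u + w - 2 * r| / r ^ 4 ≤ 3 * (s ^ 2 / r) / r ^ 4 := by gcongr
        _ = 3 * s ^ 2 / r ^ 5 := by field_simp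
    rw [abs_le] at *
    ring_nf at *
    constructor <;> linarith
  have haxial : |1 / w ^ 3 - 1 / u ^ 3| ≤ 28 * s / r ^ 4 := by
    have hlin : |3 * (u - w) / r ^ 4| ≤ 6 * s / r ^ 4 := by
      rw [abs_div, abs_mul, abs_of_pos (pow_pos hx 4), abs_of_pos (by norm_num : (0 : ℝ) < 3)]
      have huw : |u - w| ≤ 2 * s := by
        rw [abs_le] at *
        constructor <;> linarith
      exact div_le_div_of_nonneg_right (by linarith) (by positivity)
    have hquad : 44 * s ^ 2 / r ^ 5 ≤ 22 * s / r ^ 4 := by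
      rw [div_le_div_iff₀ (by positivity) (by positivity)]
      nlinarith [mul_le_mul_of_nonneg_left hq (by positivity : 0 ≤ 22 * s * r ^ 4)]
    rw [abs_le] at *
    ring_nf at *
    constructor <;> linarith
  calc _ ≤ 47 * s ^ 2 / r ^ 5 * r + 28 * s / r ^ 4 * s := by gcongr
    _ = 75 * s ^ 2 / r ^ 4 := by field_simp; ring

theorem sum_smul_second_difference {k : ℕ} (ε a : ℝ) (b c : Fin k → ℝ) (x : E) (p : Fin k → E) :
    ∑ v, (ε / 2) • ((2 / a) • x - (1 / b v) • (x + p v) - (1 / c v) • (x - p v)) =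
      (ε / a) • x - ∑ v, ((ε / 2 / b v) • (x + p v) + (ε / 2 / c v) • (x - p v)) +
        (ε * ((k : ℝ) - 1) / a) • x := by
  have hterm (v : Fin k) :
      (ε / 2) • ((2 / a) • x - (1 / b v) • (x + p v) - (1 / c v) • (x - p v)) =
        (ε / a) • x - ((ε / 2 / b v) • (x + p v) + (ε / 2 / c v) • (x - p v)) := by
    module
  rw [sum_congr rfl fun v _ => hterm v, sum_sub_distrib, sum_const, card_univ, Fintype.card_fin,
    ← Nat.cast_smul_eq_nsmul ℝ]
  module

end InverseNorm

theorem gradient_hpot {k : ℕ} (ε : ℝ) {p : Fin k → EuclideanSpace ℝ (Fin 3)}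
    {x : EuclideanSpace ℝ (Fin 3)} (hx : x ≠ 0) (hadd : ∀ v, x + p v ≠ 0)
    (hsub : ∀ v, x - p v ≠ 0) :
    gradient (hpot k ε p) x = (ε / ‖x‖ ^ 3) • x -
      ∑ v, ((ε / 2 / ‖x + p v‖ ^ 3) • (x + p v) + (ε / 2 / ‖x - p v‖ ^ 3) • (x - p v)) := by
  refine HasGradientAt.gradient ?_
  rw [hasGradientAt_iff_hasFDerivAt]
  have h0 := hasFDerivAt_div_norm_add ε (0 : EuclideanSpace ℝ (Fin 3)) (x := x) (by simpa using hx)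
  have hsum := HasFDerivAt.fun_sum (u := univ) fun v _ =>
    (hasFDerivAt_div_norm_add (ε / 2) (p v) (hadd v)).fun_add
      (hasFDerivAt_div_norm_add (ε / 2) (-p v) (x := x) (by simpa [sub_eq_add_neg] using hsub v))
  refine (((h0.const_sub 1).fun_add hsum).congr_fderiv ?_).congr_of_eventuallyEq
    (.of_forall fun y => by simp [hpot, div_div, sub_eq_add_neg])
  ext v
  simp only [add_apply, neg_apply, smul_apply, _root_.sum_apply, smul_eq_mul,
    InnerProductSpace.toDual_apply_apply, innerSL_apply_apply, inner_add_left,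
    inner_neg_left, sum_inner, real_inner_smul_left, add_zero,
    sub_eq_add_neg, ← sum_neg_distrib]
  ring_nf

/-- Decay of the gradient: `‖∇h_ε(x) + ε(k−1) x/‖x‖³‖ ≤ C ε/‖x‖⁴` at infinity. -/
theorem hpot_gradient_decay (k : ℕ) (hk : 1 ≤ k)
    (p : Fin k → EuclideanSpace ℝ (Fin 3))
    (hp0 : ∀ v, p v ≠ 0)
    (hpd : ∀ v w, v ≠ w → p v ≠ p w ∧ p v ≠ -p w) :
    ∃ C > (0 : ℝ), ∃ R > (0 : ℝ), ∀ ε : ℝ, 0 < ε → ε ≤ 1 →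
      ∀ x : EuclideanSpace ℝ (Fin 3), R ≤ ‖x‖ →
        ‖gradient (hpot k ε p) x + (ε * ((k : ℝ) - 1) / ‖x‖ ^ 3) • x‖ ≤
          C * ε / ‖x‖ ^ 4 := by
  have hR0 : 0 < 1 + ∑ v, 2 * ‖p v‖ := by positivity
  refine ⟨1 + ∑ v, 75 / 2 * ‖p v‖ ^ 2, by positivity, 1 + ∑ v, 2 * ‖p v‖, hR0,
    fun ε hε _ x hR => ?_⟩
  have hfar (v : Fin k) : 1 + 2 * ‖p v‖ ≤ ‖x‖ := by
    have := single_le_sum (f := fun v => 2 * ‖p v‖) (fun v _ => by positivity) (mem_univ v)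
    linarith
  have hx : 0 < ‖x‖ := hR0.trans_le hR
  have hne (v : Fin k) : ‖p v‖ < ‖x‖ := by linarith [hfar v, norm_nonneg (p v)]
  have hadd (v : Fin k) : x + p v ≠ 0 := fun h =>
    (hne v).ne' (by rw [eq_neg_of_add_eq_zero_left h, norm_neg])
  have hsub (v : Fin k) : x - p v ≠ 0 := fun h => (hne v).ne' (by rw [sub_eq_zero.mp h])
  have hrepr : gradient (hpot k ε p) x + (ε * ((k : ℝ) - 1) / ‖x‖ ^ 3) • x =
      ∑ v, (ε / 2) • ((2 / ‖x‖ ^ 3) • x - (1 / ‖x + p v‖ ^ 3) • (x + p v) -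
        (1 / ‖x - p v‖ ^ 3) • (x - p v)) := by
    rw [gradient_hpot ε (norm_pos_iff.mp hx) hadd hsub, sum_smul_second_difference]
  rw [hrepr]
  calc _ ≤ ∑ v, ε / 2 * (75 * ‖p v‖ ^ 2 / ‖x‖ ^ 4) := by
        refine norm_sum_le_of_le _ fun v _ => ?_
        rw [norm_smul, Real.norm_of_nonneg (by positivity)]
        gcongr
        exact norm_second_difference_le hx (by linarith [hfar v])
    _ = (∑ v, 75 / 2 * ‖p v‖ ^ 2) * ε / ‖x‖ ^ 4 := by
        rw [sum_mul, sum_div]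
        exact sum_congr rfl fun v _ => by ring
    _ ≤ (1 + ∑ v, 75 / 2 * ‖p v‖ ^ 2) * ε / ‖x‖ ^ 4 := by
        gcongr
        linarith
end

section
/- Let k ≥ 1, let p_1, …, p_k ∈ ℝ³ ∖ {0} be such that the points 0, ±p_1, …, ±p_k are pairwise distinct, and let δ ∈ (0, 1/2) with δ < min_v ‖p_v‖ / 2. Then there exists a constant C > 0, depending only on p_1, …, p_k and δ, such that for every ε ∈ (0, δ²) and every x' ∈ ℝ³ ∖ {0} with ε‖x'‖ ≤ δ, one has | h_ε(ε x') − h'_ε(x') | ≤ C ε³ ‖x'‖², where h'_ε(x') = 1 − 1/‖x'‖ + Σ_{v=1}^{k} ε/‖p_v‖. In particular, under the identification map x' = x/ε of the gluing region, the two potentials h_ε and h'_ε agree up to O(ε³). -/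
open Finset

/-- The model potential for the rescaled Atiyah–Hitchin piece:
`h'_ε(x') = 1 − 1/‖x'‖ + Σ_v ε/‖p_v‖`. -/
noncomputable def hAH (k : ℕ) (ε : ℝ) (p : Fin k → EuclideanSpace ℝ (Fin 3))
    (x' : EuclideanSpace ℝ (Fin 3)) : ℝ :=
  1 - 1 / ‖x'‖ + ∑ v, ε / ‖p v‖

/-- The average of the Newton potentials centred at `p` and `-p` agrees with its value at the
origin up to a quadratic error. -/
theorem abs_symm_inv_norm_sub_inv_norm_le {E : Type*} [NormedAddCommGroup E]
    [InnerProductSpace ℝ E] {x p : E} (hp : p ≠ 0) (hx : ‖x‖ ≤ ‖p‖ / 2) :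
    |1 / (2 * ‖x + p‖) + 1 / (2 * ‖x - p‖) - 1 / ‖p‖| ≤ 6 / ‖p‖ ^ 3 * ‖x‖ ^ 2 := by
  have hr : 0 < ‖p‖ := norm_pos_iff.mpr hp
  have hpar := parallelogram_law_with_norm ℝ x p
  have ha : |‖x + p‖ - ‖p‖| ≤ ‖x‖ := by
    simpa using abs_norm_sub_norm_le (x + p) p
  have hb : |‖x - p‖ - ‖p‖| ≤ ‖x‖ := by
    rw [norm_sub_rev x p]
    simpa using abs_norm_sub_norm_le (p - x) p
  generalize ‖x + p‖ = a at *
  generalize ‖x - p‖ = b at *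
  generalize ‖x‖ = s at *
  generalize ‖p‖ = r at *
  have hu := sq_le_sq' (abs_le.mp ha).1 (abs_le.mp ha).2
  have hv := sq_le_sq' (abs_le.mp hb).1 (abs_le.mp hb).2
  have ha' : r / 2 ≤ a := by linarith [(abs_le.mp ha).1]
  have hb' : r / 2 ≤ b := by linarith [(abs_le.mp hb).1]
  have ha0 : 0 < a := by linarith
  have hb0 : 0 < b := by linarith
  have hnum : |r * (a + b) - 2 * (a * b)| ≤ 3 * s ^ 2 := by
    rw [abs_le]
    constructor <;> nlinarith [sq_nonneg (a - b), sq_nonneg (a + b - 2 * r)]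
  have hden : r ^ 3 / 2 ≤ 2 * (a * b * r) := by
    have := mul_le_mul ha' hb' (by positivity) ha0.le
    nlinarith
  have heq : 1 / (2 * a) + 1 / (2 * b) - 1 / r =
      (r * (a + b) - 2 * (a * b)) / (2 * (a * b * r)) := by
    field_simp
    ring
  rw [heq, abs_div, abs_of_pos (show 0 < 2 * (a * b * r) by positivity)]
  calc |r * (a + b) - 2 * (a * b)| / (2 * (a * b * r))
      ≤ 3 * s ^ 2 / (r ^ 3 / 2) := by gcongr
    _ = 6 / r ^ 3 * s ^ 2 := by field_simp; ring

/-- Under the identification `x' = x/ε` of the gluing region, the potentials `h_ε`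
and `h'_ε` agree up to `O(ε³)`. -/
theorem hpot_matches_model_on_neck (k : ℕ) (hk : 1 ≤ k)
    (p : Fin k → EuclideanSpace ℝ (Fin 3))
    (hp0 : ∀ v, p v ≠ 0)
    (hpd : ∀ v w, v ≠ w → p v ≠ p w ∧ p v ≠ -p w)
    (δ : ℝ) (hδ0 : 0 < δ) (hδ1 : δ < 1 / 2) (hδp : ∀ v, δ < ‖p v‖ / 2) :
    ∃ C > (0 : ℝ), ∀ ε : ℝ, 0 < ε → ε < δ ^ 2 →
      ∀ x' : EuclideanSpace ℝ (Fin 3), x' ≠ 0 → ε * ‖x'‖ ≤ δ →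
        |hpot k ε p (ε • x') - hAH k ε p x'| ≤ C * ε ^ 3 * ‖x'‖ ^ 2 := by
  have hpos : ∀ v, 0 < ‖p v‖ := fun v => norm_pos_iff.mpr (hp0 v)
  have : Nonempty (Fin k) := ⟨⟨0, hk⟩⟩
  refine ⟨∑ v, 6 / ‖p v‖ ^ 3, sum_pos (fun v _ => ?_) univ_nonempty, ?_⟩
  · have := hpos v
    positivity
  intro ε hε _ x' hx' hx
  have hn : ‖ε • x'‖ = ε * ‖x'‖ := by rw [norm_smul, Real.norm_of_nonneg hε.le]
  have hx0 : 0 < ‖x'‖ := norm_pos_iff.mpr hx'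
  have hsing : ε / (ε * ‖x'‖) = 1 / ‖x'‖ := by field_simp
  have hdiff : hpot k ε p (ε • x') - hAH k ε p x' =
      ∑ v, ε * (1 / (2 * ‖ε • x' + p v‖) + 1 / (2 * ‖ε • x' - p v‖) - 1 / ‖p v‖) := by
    rw [hpot, hAH, hn, hsing, add_sub_add_left_eq_sub, ← sum_sub_distrib]
    exact sum_congr rfl fun v _ => by ring
  rw [hdiff, sum_mul, sum_mul]
  refine (abs_sum_le_sum_abs _ _).trans (sum_le_sum fun v _ => ?_)
  have hle : ‖ε • x'‖ ≤ ‖p v‖ / 2 := hn ▸ hx.trans (hδp v).le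
  rw [abs_mul, abs_of_pos hε]
  calc ε * |1 / (2 * ‖ε • x' + p v‖) + 1 / (2 * ‖ε • x' - p v‖) - 1 / ‖p v‖|
      ≤ ε * (6 / ‖p v‖ ^ 3 * ‖ε • x'‖ ^ 2) := by
        gcongr
        exact abs_symm_inv_norm_sub_inv_norm_le (hp0 v) hle
    _ = 6 / ‖p v‖ ^ 3 * ε ^ 3 * ‖x'‖ ^ 2 := by rw [hn]; ring
end
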